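/- The Schubert polynomials {𝔖_w : w ∈ S_∞} form a ℤ-basis of the polynomial ring ℤ[x_1, x_2, …] in countably many variables: they are ℤ-linearly independent and every polynomial is a ℤ-linear combination of finitely many of them. -/

import Mathlib

open MvPolynomial
open scoped Classical

/-- The polynomial ring ℤ[x₁,x₂,…]: the variable with index `i : ℕ` represents `x_{i+1}`. -/
abbrev PolyRing : Type := MvPolynomial ℕ ℤ

/-- The action of the simple transposition `s_{i+1}` on ℤ[x₁,x₂,…]
(exchanging the variables `x_{i+1}` and `x_{i+2}` and fixing all others). -/
noncomputable def sAct (i : ℕ) (f : PolyRing) : PolyRing :=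
  rename (Equiv.swap i (i + 1)) f

/-- The divided difference operator `∂_{i+1}`: the unique polynomial `g` with
`(x_{i+1} - x_{i+2}) * g = f - s_{i+1} f` (it exists, and is unique since the
polynomial ring is a domain). -/
noncomputable def divDiff (i : ℕ) (f : PolyRing) : PolyRing :=
  if h : ∃ g : PolyRing, (X i - X (i + 1)) * g = f - sAct i f then h.choose else 0

/-- Composite divided difference operator `∂_{a₁} ∘ ∂_{a₂} ∘ ⋯ ∘ ∂_{a_k}` along a word
`a = [a₁, a₂, …, a_k]` (so `∂_{a_k}` is applied first). -/
noncomputable def divDiffWord (a : List ℕ) (f : PolyRing) : PolyRing :=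
  a.foldr divDiff f

/-- The length `ℓ(w)` (number of inversions) of a permutation of `{1,2,…}`
(indices shifted down by one, so positions are indexed by `ℕ`). -/
noncomputable def len (w : Equiv.Perm ℕ) : ℕ :=
  Set.ncard {p : ℕ × ℕ | p.1 < p.2 ∧ w p.2 < w p.1}

/-- `a = [a₁, …, a_k]` is a reduced word for `w`: the product of the corresponding simple
transpositions `s_{a₁} s_{a₂} ⋯ s_{a_k}` is `w` and `k = ℓ(w)`, the number of inversions. -/
def IsReducedWord (w : Equiv.Perm ℕ) (a : List ℕ) : Prop :=
  (a.map fun i => Equiv.swap i (i + 1)).prod = w ∧ a.length = len w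

/-- The longest element `w₀` of `S_n` (reversing the first `n` positions, with positions
indexed by `ℕ` starting at `0`). -/
def wZero (n : ℕ) : Equiv.Perm ℕ :=
  Function.Involutive.toPerm (fun i => if i < n then n - 1 - i else i) (by
    intro i
    dsimp only
    split_ifs <;> omega)

/-- The staircase monomial `x₁^{n-1} x₂^{n-2} ⋯ x_{n-1}`, the Schubert polynomial of `w₀`. -/
noncomputable def staircase (n : ℕ) : PolyRing :=
  ∏ i ∈ Finset.range n, X i ^ (n - 1 - i)

/-- The Schubert polynomial of `w` computed inside `S_n`:
`𝔖_w = ∂_{a₁} ∂_{a₂} ⋯ ∂_{a_k} 𝔖_{w₀}` for a reduced word `w⁻¹ w₀ = s_{a₁} s_{a₂} ⋯ s_{a_k}`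
(any choice of reduced word gives the same answer). -/
noncomputable def schubertIn (n : ℕ) (w : Equiv.Perm ℕ) : PolyRing :=
  if h : ∃ a : List ℕ, IsReducedWord (w⁻¹ * wZero n) a then divDiffWord h.choose (staircase n)
  else 0

/-- The Schubert polynomial `𝔖_w` of a finitely supported permutation `w ∈ S_∞`, computed
inside any `S_n` containing `w` (independent of all choices). -/
noncomputable def schubert (w : Equiv.Perm ℕ) : PolyRing :=
  if h : ∃ n : ℕ, ∀ i, w i ≠ i → i < n then schubertIn h.choose w else 0


/-! ### Inversions and reduced words -/

/-- simple transposition -/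
def sT (i : ℕ) : Equiv.Perm ℕ := Equiv.swap i (i + 1)

/-- product of a word -/
def wprod (a : List ℕ) : Equiv.Perm ℕ := (a.map fun i => Equiv.swap i (i + 1)).prod

lemma wprod_nil : wprod [] = 1 := rfl
lemma wprod_cons (i : ℕ) (a : List ℕ) : wprod (i :: a) = sT i * wprod a := by
  simp [wprod, sT]
lemma wprod_append (a b : List ℕ) : wprod (a ++ b) = wprod a * wprod b := by
  simp [wprod]

/-- inversion set -/
def invS (w : Equiv.Perm ℕ) : Set (ℕ × ℕ) := {p | p.1 < p.2 ∧ w p.2 < w p.1}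

lemma len_eq (w : Equiv.Perm ℕ) : len w = (invS w).ncard := rfl

lemma sT_mul_self (i : ℕ) : sT i * sT i = 1 := by simp [sT]

lemma sT_mul_mul (i : ℕ) (w : Equiv.Perm ℕ) : sT i * (sT i * w) = w := by
  rw [← mul_assoc, sT_mul_self, one_mul]

lemma sT_apply (i k : ℕ) : sT i k = if k = i then i + 1 else if k = i + 1 then i else k := by
  simp [sT, Equiv.swap_apply_def]

lemma sT_inv (i : ℕ) : (sT i)⁻¹ = sT i := by simp [sT]

lemma inv_sT_mul_apply (i k : ℕ) (w : Equiv.Perm ℕ) : (sT i * w)⁻¹ k = w⁻¹ (sT i k) := by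
  simp [mul_inv_rev, sT_inv]

lemma invS_up (w : Equiv.Perm ℕ) (i : ℕ) (h : w⁻¹ i < w⁻¹ (i + 1)) :
    invS (sT i * w) = insert (w⁻¹ i, w⁻¹ (i + 1)) (invS w) := by
  ext ⟨p, q⟩
  simp only [invS, Set.mem_ofPred_eq, Set.mem_insert_iff, Prod.mk.injEq, Equiv.Perm.coe_mul,
    Function.comp, sT_apply]
  have e1 : p = w⁻¹ i ↔ w p = i := by rw [Equiv.Perm.eq_inv_iff_eq]
  have e2 : q = w⁻¹ (i + 1) ↔ w q = i + 1 := by rw [Equiv.Perm.eq_inv_iff_eq]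
  have e3 : p = w⁻¹ (i + 1) ↔ w p = i + 1 := by rw [Equiv.Perm.eq_inv_iff_eq]
  have e4 : q = w⁻¹ i ↔ w q = i := by rw [Equiv.Perm.eq_inv_iff_eq]
  have e5 : p = q ↔ w p = w q := w.injective.eq_iff.symm
  generalize w⁻¹ i = a at *
  generalize w⁻¹ (i+1) = b at *
  generalize w p = P at *
  generalize w q = Q at *
  split_ifs <;> omega

lemma not_mem_invS_up (w : Equiv.Perm ℕ) (i : ℕ) : (w⁻¹ i, w⁻¹ (i + 1)) ∉ invS w := by
  simp [invS]

lemma fin_up (w : Equiv.Perm ℕ) (i : ℕ) (hw : (invS w).Finite) : (invS (sT i * w)).Finite := by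
  rcases lt_or_ge (w⁻¹ i) (w⁻¹ (i + 1)) with h | h
  · rw [invS_up w i h]; exact hw.insert _
  · have h' : (sT i * w)⁻¹ i < (sT i * w)⁻¹ (i + 1) := by
      have : w⁻¹ i ≠ w⁻¹ (i+1) := by simp
      rw [inv_sT_mul_apply, inv_sT_mul_apply, sT_apply, sT_apply, if_pos rfl, if_neg (by omega),
        if_pos rfl]
      omega
    have := invS_up (sT i * w) i h'
    rw [sT_mul_mul] at this
    rw [this] at hw
    exact hw.subset (Set.subset_insert _ _)

lemma len_up (w : Equiv.Perm ℕ) (i : ℕ) (hw : (invS w).Finite) (h : w⁻¹ i < w⁻¹ (i + 1)) :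
    len (sT i * w) = len w + 1 := by
  rw [len_eq, len_eq, invS_up w i h, Set.ncard_insert_of_notMem (not_mem_invS_up w i) hw]

lemma len_down (w : Equiv.Perm ℕ) (i : ℕ) (hw : (invS w).Finite) (h : w⁻¹ (i + 1) < w⁻¹ i) :
    len (sT i * w) + 1 = len w := by
  have h' : (sT i * w)⁻¹ i < (sT i * w)⁻¹ (i + 1) := by
    rw [inv_sT_mul_apply, inv_sT_mul_apply, sT_apply, sT_apply, if_pos rfl, if_neg (by omega),
      if_pos rfl]
    exact h
  have := len_up (sT i * w) i (fin_up w i hw) h'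
  rw [sT_mul_mul] at this
  exact this.symm

lemma desc_of_len (w : Equiv.Perm ℕ) (i : ℕ) (hw : (invS w).Finite)
    (h : len (sT i * w) < len w) : w⁻¹ (i + 1) < w⁻¹ i := by
  by_contra hc
  have : w⁻¹ i ≠ w⁻¹ (i+1) := by simp
  have := len_up w i hw (by omega)
  omega

lemma eq_one_of_strictMono (w : Equiv.Perm ℕ) (h : StrictMono w) : w = 1 := by
  have e : ∀ n, w n = n := by
    have h1 : (h.orderIsoOfSurjective w w.surjective) = OrderIso.refl ℕ := Subsingleton.elim _ _
    intro n
    exact DFunLike.congr_fun h1 n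
  ext n; simp [e n]

lemma eq_one_of_no_desc (w : Equiv.Perm ℕ) (h : ∀ i, ¬ (w⁻¹ (i + 1) < w⁻¹ i)) : w = 1 := by
  have : w⁻¹ = 1 := eq_one_of_strictMono _ (strictMono_nat_of_lt_succ fun n => by
    have : w⁻¹ n ≠ w⁻¹ (n+1) := by simp
    have := h n
    omega)
  simpa using this

lemma len_one : len 1 = 0 := by
  rw [len_eq]
  have : invS 1 = ∅ := by
    ext p; simp [invS]; omega
  rw [this]; simp

lemma fin_one : (invS 1).Finite := by
  have : invS 1 = ∅ := by
    ext p; simp [invS]; omega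
  rw [this]; simp

lemma fin_wprod (a : List ℕ) : (invS (wprod a)).Finite := by
  induction a with
  | nil => exact fin_one
  | cons i a ih => rw [wprod_cons]; exact fin_up _ _ ih

lemma len_wprod_le (a : List ℕ) : len (wprod a) ≤ a.length := by
  induction a with
  | nil => simp [wprod_nil, len_one]
  | cons i a ih =>
    rw [wprod_cons]
    have hf := fin_wprod a
    rcases lt_or_ge ((wprod a)⁻¹ i) ((wprod a)⁻¹ (i + 1)) with h | h
    · rw [len_up _ _ hf h]; simpa using ih
    · have : (wprod a)⁻¹ i ≠ (wprod a)⁻¹ (i+1) := by simp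
      have := len_down _ _ hf (by omega : (wprod a)⁻¹ (i + 1) < (wprod a)⁻¹ i)
      simp; omega

lemma exists_word_aux (n : ℕ) : ∀ w : Equiv.Perm ℕ, (invS w).Finite → len w = n →
    ∃ a, wprod a = w ∧ a.length = len w := by
  induction n with
  | zero =>
    intro w hw h
    refine ⟨[], ?_, by simp [h]⟩
    rw [wprod_nil]
    refine (eq_one_of_no_desc w fun i hi => ?_).symm
    have := len_down w i hw hi
    omega
  | succ n ih =>
    intro w hw h
    by_cases hd : ∃ i, w⁻¹ (i + 1) < w⁻¹ i
    · obtain ⟨i, hi⟩ := hd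
      have := len_down w i hw hi
      obtain ⟨a, ha, hl⟩ := ih (sT i * w) (fin_up _ _ hw) (by omega)
      exact ⟨i :: a, by rw [wprod_cons, ha, sT_mul_mul], by simp; omega⟩
    · push Not at hd
      have := eq_one_of_no_desc w (fun i => not_lt.2 (hd i))
      rw [this, len_one] at h
      omega

lemma exists_word (w : Equiv.Perm ℕ) (hw : (invS w).Finite) :
    ∃ a, wprod a = w ∧ a.length = len w := exists_word_aux _ w hw rfl

lemma eq_of_invS_eq (u w : Equiv.Perm ℕ) (h : invS u = invS w) : u = w := by
  have key : ∀ p q, p < q → (u q < u p ↔ w q < w p) := by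
    intro p q hpq
    have := Set.ext_iff.1 h (p, q)
    simpa [invS, hpq] using this
  have : u * w⁻¹ = 1 := by
    apply eq_one_of_strictMono
    intro x y hxy
    obtain ⟨p, rfl⟩ := w.surjective x
    obtain ⟨q, rfl⟩ := w.surjective y
    have e1 : (u * w⁻¹) (w p) = u p := by simp
    have e2 : (u * w⁻¹) (w q) = u q := by simp
    rw [e1, e2]
    rcases lt_trichotomy p q with hpq | hpq | hpq
    · have := key p q hpq
      have : u p ≠ u q := fun hh => by have := u.injective hh; omega
      omega
    · subst hpq; omega
    · have := key q p hpq
      omega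
  exact mul_inv_eq_one.1 this

lemma invS_sub (w : Equiv.Perm ℕ) (n : ℕ) (hw : ∀ i, w i ≠ i → i < n) :
    invS w ⊆ {p | p.1 < p.2 ∧ p.2 < n} := by
  rintro ⟨p, q⟩ ⟨h1, h2⟩
  refine ⟨h1, ?_⟩
  by_contra hc
  simp only at h1 h2 hc
  have hq : w q = q := by by_contra h; exact hc (hw q h)
  have hp : w (w p) = w p := by
    by_contra h; have := hw _ h; omega
  have := w.injective hp
  omega

lemma fin_tri (n : ℕ) : {p : ℕ × ℕ | p.1 < p.2 ∧ p.2 < n}.Finite := by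
  apply ((Finset.range n) ×ˢ (Finset.range n)).finite_toSet.subset
  rintro ⟨p, q⟩ ⟨h1, h2⟩
  simp at *; omega

lemma wZero_apply (n i : ℕ) : wZero n i = if i < n then n - 1 - i else i := rfl

lemma wZero_wZero (n i : ℕ) : wZero n (wZero n i) = i := by
  simp only [wZero_apply]; split_ifs <;> omega

lemma invS_wZero (n : ℕ) : invS (wZero n) = {p | p.1 < p.2 ∧ p.2 < n} := by
  ext ⟨p, q⟩
  simp only [invS, Set.mem_ofPred_eq, wZero_apply]
  split_ifs <;> omega

lemma supp_inv (w : Equiv.Perm ℕ) (n : ℕ) (hw : ∀ i, w i ≠ i → i < n) :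
    ∀ i, w⁻¹ i ≠ i → i < n := by
  intro i hi
  apply hw i
  intro h
  apply hi
  rw [Equiv.Perm.inv_eq_iff_eq, h]

lemma supp_apply_lt (w : Equiv.Perm ℕ) (n : ℕ) (hw : ∀ i, w i ≠ i → i < n) (i : ℕ) (hi : i < n) :
    w i < n := by
  by_contra hc
  have : w (w i) = w i := by by_contra h; exact hc (hw _ h)
  have := w.injective this
  omega

lemma supp_mul_wZero (w : Equiv.Perm ℕ) (n : ℕ) (hw : ∀ i, w i ≠ i → i < n) :
    ∀ i, (w⁻¹ * wZero n) i ≠ i → i < n := by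
  intro i hi
  by_contra hc
  apply hi
  have : wZero n i = i := by simp [wZero_apply, hc]
  rw [Equiv.Perm.mul_apply, this]
  by_contra h
  exact hc (supp_inv w n hw i h)

lemma len_compl (w : Equiv.Perm ℕ) (n : ℕ) (hw : ∀ i, w i ≠ i → i < n) :
    len w + len (w⁻¹ * wZero n) = len (wZero n) := by
  rw [len_eq, len_eq, len_eq, invS_wZero]
  have hsub := invS_sub w n hw
  rw [← Set.ncard_sdiff_add_ncard_of_subset hsub (fin_tri n), add_comm]
  congr 1
  have : invS (w⁻¹ * wZero n) = (fun p : ℕ × ℕ => (wZero n (w p.2), wZero n (w p.1))) ''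
      ({p | p.1 < p.2 ∧ p.2 < n} \ invS w) := by
    ext ⟨a, b⟩
    constructor
    · intro h
      have hb := invS_sub _ n (supp_mul_wZero w n hw) h
      obtain ⟨h1, h2⟩ := h
      obtain ⟨_, hb⟩ := hb
      simp only [Equiv.Perm.mul_apply] at h1 h2 hb
      have i0 := supp_inv w n hw
      have ha' : wZero n a < n := by simp only [wZero_apply]; split_ifs <;> omega
      refine ⟨(w⁻¹ (wZero n b), w⁻¹ (wZero n a)), ⟨⟨h2, supp_apply_lt _ n i0 _ ha'⟩, ?_⟩, ?_⟩
      · rintro ⟨_, h4⟩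
        have h5 : ∀ x, w (w⁻¹ x) = x := by simp
        simp only [h5, wZero_apply] at h4
        split_ifs at h4 <;> omega
      · simp [wZero_wZero]
    · rintro ⟨⟨p, q⟩, ⟨⟨h1, h2⟩, h3⟩, h⟩
      simp only [Prod.mk.injEq] at h
      obtain ⟨rfl, rfl⟩ := h
      simp only [invS, Set.mem_ofPred_eq, not_and, not_lt] at h1 h2 h3
      have h3 := h3 h1
      have hne : w p ≠ w q := fun hh => by have := w.injective hh; omega
      have hp := supp_apply_lt w n hw p (by omega)
      have hq := supp_apply_lt w n hw q (by omega)
      refine ⟨?_, ?_⟩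
      · simp only [wZero_apply]; split_ifs; omega
      · simpa [wZero_wZero] using h1
  rw [this, Set.ncard_image_of_injective]
  rintro ⟨a, b⟩ ⟨c, d⟩ h
  simp only [Prod.mk.injEq, EmbeddingLike.apply_eq_iff_eq] at h
  simp [h.1, h.2]

/-! ### Divided differences -/

lemma xsub_ne (i j : ℕ) (h : i ≠ j) : (X i - X j : PolyRing) ≠ 0 := by
  intro hc
  exact h (X_injective (sub_eq_zero.1 hc))

/-- the possible exponents in a divided difference of a monomial -/
def expRel (i : ℕ) (d e : ℕ →₀ ℕ) : Prop :=
  e i + e (i + 1) + 1 = d i + d (i + 1) ∧ e i < max (d i) (d (i + 1)) ∧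
    e (i + 1) < max (d i) (d (i + 1)) ∧ ∀ k, k ≠ i → k ≠ i + 1 → e k = d k

/-- image of a set of exponents -/
def expImg (i : ℕ) (S : Set (ℕ →₀ ℕ)) : Set (ℕ →₀ ℕ) := {e | ∃ d ∈ S, expRel i d e}

lemma dd_mono_aux (i : ℕ) (d' : ℕ →₀ ℕ) (h0 : d' i = 0) (h1 : d' (i + 1) = 0) (c r : ℕ) :
    ∃ g : PolyRing, (X i - X (i + 1)) * g = monomial d' 1 * X i ^ (c + r) * X (i + 1) ^ c
        - monomial d' 1 * X i ^ c * X (i + 1) ^ (c + r) ∧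
      g ∈ restrictSupport ℤ {e : ℕ →₀ ℕ | e i + e (i + 1) + 1 = c + r + c ∧ e i < c + r ∧
        e (i + 1) < c + r ∧ ∀ k, k ≠ i → k ≠ i + 1 → e k = d' k} := by
  refine ⟨∑ j ∈ Finset.range r, monomial d' 1 * X i ^ (c + j) * X (i + 1) ^ (c + (r - 1 - j)),
    ?_, ?_⟩
  · have := (Commute.all (X i : PolyRing) (X (i + 1))).geom_sum₂_mul r
    have e : ∑ j ∈ Finset.range r, (monomial d' 1 * X i ^ (c + j) * X (i + 1) ^ (c + (r - 1 - j)) :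
        PolyRing) = monomial d' 1 * X i ^ c * X (i + 1) ^ c *
        ∑ j ∈ Finset.range r, (X i ^ j * X (i + 1) ^ (r - 1 - j)) := by
      rw [Finset.mul_sum]
      refine Finset.sum_congr rfl fun j _ => ?_
      ring
    rw [e]
    linear_combination (monomial d' 1 * X i ^ c * X (i + 1) ^ c : PolyRing) * this
  · refine Submodule.sum_mem _ fun j hj => ?_
    have e : (monomial d' 1 * X i ^ (c + j) * X (i + 1) ^ (c + (r - 1 - j)) : PolyRing) =
        monomial (d' + Finsupp.single i (c + j) + Finsupp.single (i + 1) (c + (r - 1 - j))) 1 := by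
      rw [X_pow_eq_monomial, X_pow_eq_monomial, monomial_mul, monomial_mul]; simp
    rw [e, mem_restrictSupport_iff]
    intro x hx
    have hx' := support_monomial_subset hx
    rw [Finset.mem_singleton] at hx'
    subst hx'
    rw [Finset.mem_range] at hj
    simp only [Set.mem_ofPred_eq, Finsupp.add_apply, Finsupp.single_apply, h0, h1]
    refine ⟨?_, ?_, ?_, fun k hk hk' => ?_⟩
    · simp; omega
    · simp; omega
    · simp; omega
    · simp [hk.symm, hk'.symm]

lemma dd_mono (i : ℕ) (d : ℕ →₀ ℕ) :
    ∃ g : PolyRing, (X i - X (i + 1)) * g = monomial d 1 - sAct i (monomial d 1) ∧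
      g ∈ restrictSupport ℤ {e : ℕ →₀ ℕ | expRel i d e} := by
  set d' := (d.erase i).erase (i + 1) with hd'
  have h0 : d' i = 0 := by simp [hd']
  have h1 : d' (i + 1) = 0 := by simp [hd']
  have hk : ∀ k, k ≠ i → k ≠ i + 1 → d' k = d k := by
    intro k a b; simp [hd', a, b]
  have hd : d = d' + Finsupp.single i (d i) + Finsupp.single (i + 1) (d (i + 1)) := by
    ext k
    by_cases a : k = i
    · subst a; simp [h0]
    · by_cases b : k = i + 1
      · subst b; simp [h1]
      · simp [hk k a b, Ne.symm a, Ne.symm b]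
  have hm : (monomial d 1 : PolyRing) = monomial d' 1 * X i ^ (d i) * X (i + 1) ^ (d (i + 1)) := by
    rw [X_pow_eq_monomial, X_pow_eq_monomial, monomial_mul, monomial_mul]
    conv_lhs => rw [hd]
    simp
  have hs : sAct i (monomial d' 1) = monomial d' 1 := by
    rw [sAct, rename_monomial]
    refine congrArg (fun m => (monomial m 1 : PolyRing)) ?_
    ext k
    have : k = Equiv.swap i (i + 1) (Equiv.swap i (i + 1) k) := by simp
    conv_lhs => rw [this]
    rw [Finsupp.mapDomain_apply (Equiv.injective _)]
    rw [Equiv.swap_apply_def]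
    split_ifs with a b
    · rw [a, h0, h1]
    · rw [b, h0, h1]
    · rfl
  have hsm : sAct i (monomial d 1) = monomial d' 1 * X (i + 1) ^ (d i) * X i ^ (d (i + 1)) := by
    rw [hm]
    conv_rhs => rw [← hs]
    simp [sAct]
  rw [hsm, hm]
  rcases le_total (d (i + 1)) (d i) with h | h
  · obtain ⟨r, hr⟩ := Nat.exists_eq_add_of_le h
    obtain ⟨g, hg, hg'⟩ := dd_mono_aux i d' h0 h1 (d (i + 1)) r
    refine ⟨g, ?_, restrictSupport_mono ℤ ?_ hg'⟩
    · rw [hg, hr]; ring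
    · rintro e ⟨a1, a2, a3, a4⟩
      exact ⟨by omega, by omega, by omega, fun k x y => by rw [a4 k x y, hk k x y]⟩
  · obtain ⟨r, hr⟩ := Nat.exists_eq_add_of_le h
    obtain ⟨g, hg, hg'⟩ := dd_mono_aux i d' h0 h1 (d i) r
    refine ⟨-g, ?_, Submodule.neg_mem _ (restrictSupport_mono ℤ ?_ hg')⟩
    · rw [mul_neg, hg, hr]; ring
    · rintro e ⟨a1, a2, a3, a4⟩
      exact ⟨by omega, by omega, by omega, fun k x y => by rw [a4 k x y, hk k x y]⟩

lemma dd_exists (i : ℕ) (f : PolyRing) :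
    ∃ g : PolyRing, (X i - X (i + 1)) * g = f - sAct i f ∧
      g ∈ restrictSupport ℤ (expImg i (f.support : Set (ℕ →₀ ℕ))) := by
  choose G hG hG' using dd_mono i
  refine ⟨∑ d ∈ f.support, C (coeff d f) * G d, ?_, ?_⟩
  · conv_rhs => rw [f.as_sum]
    rw [Finset.mul_sum, sAct, map_sum, ← Finset.sum_sub_distrib]
    refine Finset.sum_congr rfl fun d _ => ?_
    have e : (monomial d (coeff d f) : PolyRing) = C (coeff d f) * monomial d 1 := by
      rw [C_mul_monomial, mul_one]
    have := hG d
    rw [sAct] at this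
    rw [e, map_mul, rename_C]
    linear_combination (C (coeff d f) : PolyRing) * this
  · refine Submodule.sum_mem _ fun d hd => ?_
    rw [← smul_eq_C_mul]
    refine Submodule.smul_mem _ _ (restrictSupport_mono ℤ ?_ (hG' d))
    intro e he
    exact ⟨d, hd, he⟩

lemma divDiff_spec (i : ℕ) (f : PolyRing) :
    (X i - X (i + 1)) * divDiff i f = f - sAct i f := by
  have h : ∃ g : PolyRing, (X i - X (i + 1)) * g = f - sAct i f :=
    let ⟨g, hg, _⟩ := dd_exists i f; ⟨g, hg⟩
  rw [divDiff, dif_pos h]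
  exact h.choose_spec

lemma divDiff_unique (i : ℕ) (f g : PolyRing) (h : (X i - X (i + 1)) * g = f - sAct i f) :
    divDiff i f = g :=
  mul_left_cancel₀ (xsub_ne i (i + 1) (by omega)) ((divDiff_spec i f).trans h.symm)

lemma divDiff_supp (i : ℕ) (f : PolyRing) (S : Set (ℕ →₀ ℕ)) (hf : f ∈ restrictSupport ℤ S) :
    divDiff i f ∈ restrictSupport ℤ (expImg i S) := by
  obtain ⟨g, hg, hg'⟩ := dd_exists i f
  rw [divDiff_unique i f g hg]
  refine restrictSupport_mono ℤ ?_ hg'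
  rintro e ⟨d, hd, h⟩
  exact ⟨d, ((mem_restrictSupport_iff ℤ).1 hf) hd, h⟩

/-- the divided difference as a linear map -/
noncomputable def ddL (i : ℕ) : PolyRing →ₗ[ℤ] PolyRing where
  toFun := divDiff i
  map_add' f g := by
    apply divDiff_unique
    rw [mul_add, divDiff_spec, divDiff_spec]
    simp only [sAct, map_add]; ring
  map_smul' c f := by
    apply divDiff_unique
    rw [mul_smul_comm, RingHom.id_apply, divDiff_spec]
    simp only [sAct, map_smul, smul_sub]

/-- word operator as a linear map -/
noncomputable def ddW : List ℕ → PolyRing →ₗ[ℤ] PolyRing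
  | [] => LinearMap.id
  | i :: a => (ddL i).comp (ddW a)

lemma ddW_apply (a : List ℕ) (f : PolyRing) : ddW a f = divDiffWord a f := by
  induction a with
  | nil => rfl
  | cons i a ih => simp only [ddW, LinearMap.comp_apply, ih]; rfl

lemma ddW_cons (i : ℕ) (a : List ℕ) : ddW (i :: a) = (ddL i).comp (ddW a) := rfl

lemma ddW_append (a b : List ℕ) : ddW (a ++ b) = (ddW a).comp (ddW b) := by
  induction a with
  | nil => rfl
  | cons i a ih => rw [List.cons_append, ddW_cons, ih, ddW_cons, LinearMap.comp_assoc]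

lemma ddL_spec (i : ℕ) (f : PolyRing) :
    (X i - X (i + 1)) * ddL i f = f - rename (sT i) f := divDiff_spec i f

lemma ddL_unique (i : ℕ) (f g : PolyRing) (h : (X i - X (i + 1)) * g = f - rename (sT i) f) :
    ddL i f = g := divDiff_unique i f g h

lemma ddL_eq_zero_iff (i : ℕ) (f : PolyRing) : ddL i f = 0 ↔ rename (sT i) f = f := by
  have := ddL_spec i f
  constructor
  · intro h; rw [h, mul_zero] at this; exact (sub_eq_zero.1 this.symm).symm
  · intro h; apply ddL_unique; rw [h]; simp

lemma rename_sT_sT (i : ℕ) (f : PolyRing) : rename (sT i) (rename (sT i) f) = f := by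
  rw [rename_rename, ← Equiv.Perm.coe_mul, sT_mul_self]
  simp

lemma ddL_sq' (i : ℕ) (f : PolyRing) : ddL i (ddL i f) = 0 := by
  rw [ddL_eq_zero_iff]
  have h := ddL_spec i f
  have h2 := congrArg (rename (sT i)) h
  simp only [map_mul, map_sub, rename_X, rename_sT_sT, sT_apply] at h2
  simp only [if_true, show ¬ (i + 1 = i) by omega, if_false] at h2
  apply mul_left_cancel₀ (xsub_ne i (i + 1) (by omega))
  linear_combination -h2 - h

lemma ddL_comm (i j : ℕ) (hij : i + 1 < j) (f : PolyRing) :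
    ddL i (ddL j f) = ddL j (ddL i f) := by
  have h1 := ddL_spec i f
  have h2 := ddL_spec j f
  have h3 := ddL_spec i (ddL j f)
  have h4 := ddL_spec j (ddL i f)
  have h5 := congrArg (rename (sT j)) h1
  have h6 := congrArg (rename (sT i)) h2
  have hc : rename (sT i) (rename (sT j) f) = rename (sT j) (rename (sT i) f) := by
    rw [rename_rename, rename_rename, ← Equiv.Perm.coe_mul, ← Equiv.Perm.coe_mul]
    congr 2
    ext k; simp only [Equiv.Perm.mul_apply, sT_apply]; split_ifs <;> omega
  simp only [map_mul, map_sub, rename_X, sT_apply, show i ≠ j by omega, show i ≠ j + 1 by omega,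
    show i + 1 ≠ j by omega, show j ≠ i by omega, show j ≠ i + 1 by omega,
    show j + 1 ≠ i by omega, show j + 1 ≠ i + 1 by omega, if_false,
    show i + 1 ≠ j + 1 by omega] at h5 h6
  apply mul_left_cancel₀ (xsub_ne i (i + 1) (by omega))
  apply mul_left_cancel₀ (xsub_ne j (j + 1) (by omega))
  linear_combination (X j - X (j + 1) : PolyRing) * h3 - (X i - X (i + 1) : PolyRing) * h4 +
    h2 - h6 - h1 + h5 + hc

lemma sT_a (i : ℕ) : sT i i = i + 1 := by rw [sT_apply, if_pos rfl]
lemma sT_b (i : ℕ) : sT i (i + 1) = i := by rw [sT_apply, if_neg (by omega), if_pos rfl]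
lemma sT_e (i k : ℕ) (h1 : k ≠ i) (h2 : k ≠ i + 1) : sT i k = k := by
  rw [sT_apply, if_neg h1, if_neg h2]
lemma sT_c (i : ℕ) : sT i (i + 1 + 1) = i + 1 + 1 := sT_e _ _ (by omega) (by omega)
lemma sT_d (i : ℕ) : sT (i + 1) i = i := sT_e _ _ (by omega) (by omega)

lemma sT_braid (i : ℕ) : sT i * (sT (i + 1) * sT i) = sT (i + 1) * (sT i * sT (i + 1)) := by
  ext k
  simp only [Equiv.Perm.mul_apply]
  by_cases h1 : k = i
  · subst h1; simp only [sT_a, sT_b, sT_c, sT_d]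
  · by_cases h2 : k = i + 1
    · subst h2; simp only [sT_a, sT_b, sT_c, sT_d]
    · by_cases h3 : k = i + 1 + 1
      · subst h3; simp only [sT_a, sT_b, sT_c, sT_d]
      · simp only [sT_e i k h1 h2, sT_e (i + 1) k h2 h3]

lemma sT_comm (i j : ℕ) (h : i + 1 < j) : sT i * sT j = sT j * sT i := by
  ext k; simp only [Equiv.Perm.mul_apply, sT_apply]; split_ifs <;> omega

lemma ddL_inv (i : ℕ) (f : PolyRing) : rename (sT i) (ddL i f) = ddL i f :=
  (ddL_eq_zero_iff i _).1 (ddL_sq' i f)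

lemma ddL_braid1 (i : ℕ) (f : PolyRing) :
    (X i - X (i + 1)) * ((X (i + 1) - X (i + 1 + 1)) * ((X i - X (i + 1 + 1)) *
      ddL i (ddL (i + 1) (ddL i f)))) = f - rename (sT i) f - rename (sT (i + 1)) f
      + rename (sT (i + 1)) (rename (sT i) f) + rename (sT i) (rename (sT (i + 1)) f)
      - rename (sT i) (rename (sT (i + 1)) (rename (sT i) f)) := by
  have a1 := ddL_spec i f
  have a2 := ddL_spec (i + 1) (ddL i f)
  have a3 := ddL_spec i (ddL (i + 1) (ddL i f))
  have ta1 := congrArg (rename (sT (i + 1))) a1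
  have sa2 := congrArg (rename (sT i)) a2
  have sta1 := congrArg (rename (sT i)) ta1
  simp only [map_mul, map_sub, rename_X, sT_a, sT_b, sT_c, sT_d, ddL_inv] at ta1 sa2 sta1
  linear_combination (X (i + 1) - X (i + 1 + 1) : PolyRing) * (X i - X (i + 1 + 1)) * a3 +
    (X i - X (i + 1 + 1)) * a2 - (X (i + 1) - X (i + 1 + 1)) * sa2 + a1 - ta1 + sta1

lemma ddL_braid2 (i : ℕ) (f : PolyRing) :
    (X i - X (i + 1)) * ((X (i + 1) - X (i + 1 + 1)) * ((X i - X (i + 1 + 1)) *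
      ddL (i + 1) (ddL i (ddL (i + 1) f)))) = f - rename (sT i) f - rename (sT (i + 1)) f
      + rename (sT (i + 1)) (rename (sT i) f) + rename (sT i) (rename (sT (i + 1)) f)
      - rename (sT (i + 1)) (rename (sT i) (rename (sT (i + 1)) f)) := by
  have a1 := ddL_spec (i + 1) f
  have a2 := ddL_spec i (ddL (i + 1) f)
  have a3 := ddL_spec (i + 1) (ddL i (ddL (i + 1) f))
  have ta1 := congrArg (rename (sT i)) a1
  have sa2 := congrArg (rename (sT (i + 1))) a2
  have sta1 := congrArg (rename (sT (i + 1))) ta1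
  simp only [map_mul, map_sub, rename_X, sT_a, sT_b, sT_c, sT_d, ddL_inv] at ta1 sa2 sta1
  linear_combination (X i - X (i + 1) : PolyRing) * (X i - X (i + 1 + 1)) * a3 +
    (X i - X (i + 1 + 1)) * a2 - (X i - X (i + 1)) * sa2 + a1 - ta1 + sta1

lemma ddL_braid (i : ℕ) (f : PolyRing) :
    ddL i (ddL (i + 1) (ddL i f)) = ddL (i + 1) (ddL i (ddL (i + 1) f)) := by
  apply mul_left_cancel₀ (xsub_ne i (i + 1 + 1) (by omega))
  apply mul_left_cancel₀ (xsub_ne (i + 1) (i + 1 + 1) (by omega))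
  apply mul_left_cancel₀ (xsub_ne i (i + 1) (by omega))
  rw [ddL_braid1, ddL_braid2]
  have hc : rename (sT i) (rename (sT (i + 1)) (rename (sT i) f)) =
      rename (sT (i + 1)) (rename (sT i) (rename (sT (i + 1)) f)) := by
    simp only [rename_rename, ← Equiv.Perm.coe_mul, sT_braid]
  rw [hc]

/-! ### Independence of the reduced word -/

/-- reduced word -/
def red (a : List ℕ) : Prop := a.length = len (wprod a)

lemma red_tail (i : ℕ) (a : List ℕ) (h : red (i :: a)) : red a := by
  have h1 := len_wprod_le a
  unfold red at *
  rw [wprod_cons] at h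
  have hf := fin_wprod a
  simp only [List.length_cons] at h
  rcases lt_or_ge ((wprod a)⁻¹ i) ((wprod a)⁻¹ (i + 1)) with h' | h'
  · rw [len_up _ _ hf h'] at h; omega
  · have : (wprod a)⁻¹ i ≠ (wprod a)⁻¹ (i+1) := by simp
    have := len_down _ _ hf (by omega : (wprod a)⁻¹ (i + 1) < (wprod a)⁻¹ i)
    omega

lemma red_head_desc (i : ℕ) (a : List ℕ) (h : red (i :: a)) :
    (wprod (i :: a))⁻¹ (i + 1) < (wprod (i :: a))⁻¹ i := by
  apply desc_of_len _ _ (fin_wprod _)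
  have h2 := red_tail i a h
  rw [wprod_cons, sT_mul_mul]
  unfold red at h h2
  rw [wprod_cons] at h
  simp only [List.length_cons] at h
  omega

lemma red_cons (i : ℕ) (a : List ℕ) (h : red a) (w : Equiv.Perm ℕ) (hw : sT i * w = wprod a)
    (hd : w⁻¹ (i + 1) < w⁻¹ i) : red (i :: a) ∧ wprod (i :: a) = w := by
  have e : wprod (i :: a) = w := by rw [wprod_cons, ← hw, sT_mul_mul]
  refine ⟨?_, e⟩
  have hf := fin_wprod (i :: a)
  rw [e] at hf
  unfold red at *
  rw [e, ← len_down w i hf hd, hw]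
  simp only [List.length_cons]; omega

lemma matsumoto_aux (n : ℕ) : ∀ a b : List ℕ, a.length = n → b.length = n → red a → red b →
    wprod a = wprod b → ddW a = ddW b := by
  induction n with
  | zero =>
    intro a b ha hb _ _ _
    rw [List.length_eq_zero_iff] at ha hb
    rw [ha, hb]
  | succ n ih =>
    have main : ∀ (i j : ℕ) (a b : List ℕ), i < j → a.length = n → b.length = n → red (i :: a) →
        red (j :: b) → wprod (i :: a) = wprod (j :: b) → ddW (i :: a) = ddW (j :: b) := by
      intro i j a b hij ha hb ra rb hab
      have ra' := red_tail i a ra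
      have rb' := red_tail j b rb
      have di := red_head_desc i a ra
      have dj := red_head_desc j b rb
      rw [← hab] at dj
      have hw1 : sT i * wprod (i :: a) = wprod a := by rw [wprod_cons, sT_mul_mul]
      have hw2 : sT j * wprod (i :: a) = wprod b := by rw [hab, wprod_cons, sT_mul_mul]
      have hf := fin_wprod (i :: a)
      generalize wprod (i :: a) = w at *
      rw [ddW_cons, ddW_cons]
      rcases Nat.lt_or_ge (i + 1) j with h | h
      · -- commuting case
        obtain ⟨e, he, hel⟩ := exists_word (sT j * (sT i * w)) (fin_up _ _ (fin_up _ _ hf))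
        have re : red e := by unfold red; rw [he]; exact hel
        have c1 := red_cons j e re (sT i * w) he.symm (by
          rw [inv_sT_mul_apply, inv_sT_mul_apply, sT_e _ _ (by omega) (by omega),
            sT_e _ _ (by omega) (by omega)]
          exact dj)
        have c2 := red_cons i e re (sT j * w)
          (by rw [he, ← mul_assoc, sT_comm i j h, mul_assoc]) (by
          rw [inv_sT_mul_apply, inv_sT_mul_apply, sT_e _ _ (by omega) (by omega),
            sT_e _ _ (by omega) (by omega)]
          exact di)
        have l1 : (j :: e).length = n := by
          have := c1.1; unfold red at this ra'; rw [this, c1.2, hw1, ← ra', ha]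
        have l2 : (i :: e).length = n := by simpa using l1
        rw [ih a (j :: e) ha l1 ra' c1.1 (by rw [c1.2, hw1]),
          ih b (i :: e) hb l2 rb' c2.1 (by rw [c2.2, hw2]), ddW_cons, ddW_cons]
        refine LinearMap.ext fun f => ?_
        simp only [LinearMap.comp_apply]
        exact ddL_comm i j h _
      · obtain rfl : j = i + 1 := by omega
        obtain ⟨e, he, hel⟩ := exists_word (sT i * (sT (i + 1) * (sT i * w)))
          (fin_up _ _ (fin_up _ _ (fin_up _ _ hf)))
        have re : red e := by unfold red; rw [he]; exact hel
        have he' : sT (i + 1) * (sT i * (sT (i + 1) * w)) = wprod e := by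
          rw [he]
          have := congrArg (· * w) (sT_braid i)
          simpa only [mul_assoc] using this.symm
        have c1 := red_cons i e re (sT (i + 1) * (sT i * w)) he.symm (by
          simp only [inv_sT_mul_apply, sT_a, sT_b, sT_c, sT_d]
          exact dj)
        have c1' := red_cons (i + 1) (i :: e) c1.1 (sT i * w) c1.2.symm (by
          simp only [inv_sT_mul_apply, sT_a, sT_b, sT_c, sT_d]
          omega)
        have c2 := red_cons (i + 1) e re (sT i * (sT (i + 1) * w)) he' (by
          simp only [inv_sT_mul_apply, sT_a, sT_b, sT_c, sT_d]
          exact di)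
        have c2' := red_cons i ((i + 1) :: e) c2.1 (sT (i + 1) * w) c2.2.symm (by
          simp only [inv_sT_mul_apply, sT_a, sT_b, sT_c, sT_d]
          omega)
        have l1 : ((i + 1) :: i :: e).length = n := by
          have := c1'.1; unfold red at this ra'; rw [this, c1'.2, hw1, ← ra', ha]
        have l2 : (i :: (i + 1) :: e).length = n := by simpa using l1
        rw [ih a _ ha l1 ra' c1'.1 (by rw [c1'.2, hw1]),
          ih b _ hb l2 rb' c2'.1 (by rw [c2'.2, hw2]), ddW_cons, ddW_cons, ddW_cons, ddW_cons]
        refine LinearMap.ext fun f => ?_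
        simp only [LinearMap.comp_apply]
        exact ddL_braid i _
    intro a b ha hb ra rb hab
    match a, b, ha, hb with
    | i :: a, j :: b, ha, hb =>
      simp only [List.length_cons, Nat.add_right_cancel_iff] at ha hb
      rcases lt_trichotomy i j with h | h | h
      · exact main i j a b h ha hb ra rb hab
      · subst h
        rw [ddW_cons, ddW_cons, ih a b ha hb (red_tail _ _ ra) (red_tail _ _ rb)]
        rw [wprod_cons, wprod_cons] at hab
        exact mul_left_cancel hab
      · exact (main j i b a h hb ha rb ra hab.symm).symm

lemma matsumoto (a b : List ℕ) (ra : red a) (rb : red b) (h : wprod a = wprod b) :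
    ddW a = ddW b :=
  matsumoto_aux a.length a b rfl (by unfold red at ra rb; rw [rb, ra, h]) ra rb h

lemma ddW_nonred (a : List ℕ) (h : ¬ red a) : ddW a = 0 := by
  induction a with
  | nil => exact absurd (by simp [red, wprod_nil, len_one]) h
  | cons i a ih =>
    by_cases ra : red a
    · have hf := fin_wprod a
      have hd : (wprod a)⁻¹ (i + 1) < (wprod a)⁻¹ i := by
        by_contra hc
        have : (wprod a)⁻¹ i ≠ (wprod a)⁻¹ (i+1) := by simp
        have := len_up _ _ hf (by omega : (wprod a)⁻¹ i < (wprod a)⁻¹ (i + 1))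
        apply h
        unfold red at *
        rw [wprod_cons, this, ← ra]
        rfl
      obtain ⟨e, he, hel⟩ := exists_word (sT i * wprod a) (fin_up _ _ hf)
      have re : red e := by unfold red; rw [he]; exact hel
      have c := red_cons i e re (wprod a) he.symm hd
      rw [ddW_cons, matsumoto a (i :: e) ra c.1 c.2.symm, ddW_cons]
      refine LinearMap.ext fun f => ?_
      exact ddL_sq' i _
    · rw [ddW_cons, ih ra]; simp

/-! ### The staircase -/

/-- explicit word for the longest element -/
def topWord : ℕ → List ℕ
  | 0 => []
  | n + 1 => List.range n ++ topWord n

lemma topWord_lt (n : ℕ) : ∀ i ∈ topWord n, i + 1 < n := by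
  induction n with
  | zero => simp [topWord]
  | succ n ih =>
    intro i hi
    simp only [topWord, List.mem_append, List.mem_range] at hi
    rcases hi with h | h
    · omega
    · have := ih i h; omega

lemma wprod_range (n : ℕ) (k : ℕ) :
    wprod (List.range n) k = if k < n then k + 1 else if k = n then 0 else k := by
  induction n generalizing k with
  | zero => simp [wprod_nil]
  | succ n ih =>
    rw [List.range_succ, wprod_append, Equiv.Perm.mul_apply, wprod_cons, wprod_nil, mul_one,
      sT_apply, ih]
    split_ifs <;> omega

lemma wprod_topWord (n : ℕ) : wprod (topWord n) = wZero n := by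
  induction n with
  | zero => ext k; simp [topWord, wprod_nil, wZero_apply]
  | succ n ih =>
    ext k
    rw [topWord, wprod_append, ih, Equiv.Perm.mul_apply, wprod_range, wZero_apply, wZero_apply]
    split_ifs <;> omega

/-- product of the first variables -/
noncomputable def eProd (n : ℕ) : PolyRing := ∏ i ∈ Finset.range n, X i

lemma staircase_succ (n : ℕ) : staircase (n + 1) = eProd n * staircase n := by
  unfold staircase eProd
  rw [Finset.prod_range_succ, ← Finset.prod_mul_distrib]
  simp only [Nat.add_sub_cancel, Nat.sub_self, pow_zero, mul_one]
  refine Finset.prod_congr rfl fun i hi => ?_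
  rw [Finset.mem_range] at hi
  rw [← pow_succ']
  congr 1; omega

lemma ddL_mul_inv (i : ℕ) (g f : PolyRing) (h : rename (sT i) g = g) :
    ddL i (g * f) = g * ddL i f := by
  apply ddL_unique
  rw [map_mul, h]
  linear_combination g * ddL_spec i f

lemma eProd_inv_lt (i n : ℕ) (h : i + 1 < n) : rename (sT i) (eProd n) = eProd n := by
  unfold eProd
  rw [map_prod]
  simp only [rename_X]
  apply Finset.prod_bij (fun k _ => sT i k)
  · intro k hk
    rw [Finset.mem_range] at *
    rw [sT_apply]; split_ifs <;> omega
  · intro a _ b _ hab; exact (sT i).injective hab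
  · intro b hb
    refine ⟨sT i b, ?_, ?_⟩
    · rw [Finset.mem_range] at *
      rw [sT_apply]; split_ifs <;> omega
    · rw [← Equiv.Perm.mul_apply, sT_mul_self]; rfl
  · intro a _; rfl

lemma eProd_inv_ge (i n : ℕ) (h : n ≤ i) : rename (sT i) (eProd n) = eProd n := by
  unfold eProd
  rw [map_prod]
  refine Finset.prod_congr rfl fun k hk => ?_
  rw [Finset.mem_range] at hk
  rw [rename_X, sT_e _ _ (by omega) (by omega)]

lemma ddW_mul_eProd (n : ℕ) (a : List ℕ) (h : ∀ i ∈ a, i + 1 < n) (f : PolyRing) :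
    ddW a (eProd n * f) = eProd n * ddW a f := by
  induction a with
  | nil => rfl
  | cons i a ih =>
    rw [ddW_cons, LinearMap.comp_apply, LinearMap.comp_apply,
      ih (fun j hj => h j (List.mem_cons_of_mem _ hj)),
      ddL_mul_inv _ _ _ (eProd_inv_lt i n (h i List.mem_cons_self))]

lemma ddL_X (i : ℕ) : ddL i (X i) = 1 := by
  apply ddL_unique
  rw [rename_X, sT_a, mul_one]

lemma ddW_range_eProd (n : ℕ) : ddW (List.range n) (eProd n) = 1 := by
  induction n with
  | zero => simp [eProd, ddW]
  | succ n ih =>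
    rw [List.range_succ, ddW_append, LinearMap.comp_apply]
    have : ddW [n] (eProd (n + 1)) = eProd n := by
      change ddL n (eProd (n + 1)) = eProd n
      have e : eProd (n + 1) = eProd n * X n := by rw [eProd, Finset.prod_range_succ]; rfl
      rw [e, ddL_mul_inv _ _ _ (eProd_inv_ge n n le_rfl), ddL_X, mul_one]
    rw [this, ih]

lemma ddW_topWord (n : ℕ) : ddW (topWord n) (staircase n) = 1 := by
  induction n with
  | zero => simp [topWord, ddW, staircase]
  | succ n ih =>
    rw [topWord, ddW_append, LinearMap.comp_apply, staircase_succ,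
      ddW_mul_eProd _ _ (topWord_lt n), ih, mul_one, ddW_range_eProd]

lemma red_topWord (n : ℕ) : red (topWord n) := by
  by_contra h
  have := ddW_topWord n
  rw [ddW_nonred _ h] at this
  simp at this

lemma ddW_wZero (n : ℕ) (a : List ℕ) (ha : red a) (h : wprod a = wZero n) :
    ddW a (staircase n) = 1 := by
  rw [matsumoto a (topWord n) ha (red_topWord n) (by rw [h, wprod_topWord]), ddW_topWord]

/-- exponents below the staircase with codegree `k` -/
def stairSet (n k : ℕ) : Set (ℕ →₀ ℕ) :=
  {e | (∀ i, e i ≤ n - 1 - i) ∧ (∑ i ∈ Finset.range n, e i) + k = ∑ i ∈ Finset.range n, (n - 1 - i)}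

lemma expImg_stairSet (i n k : ℕ) : expImg i (stairSet n k) ⊆ stairSet n (k + 1) := by
  rintro e ⟨d, ⟨h1, h2⟩, r1, r2, r3, r4⟩
  have hi := h1 i
  have hi1 := h1 (i + 1)
  have hn : i + 1 < n := by omega
  refine ⟨fun j => ?_, ?_⟩
  · by_cases a : j = i
    · subst a; omega
    · by_cases b : j = i + 1
      · subst b; omega
      · rw [r4 j a b]; exact h1 j
  · rw [← h2]
    have hs : ∀ f : ℕ →₀ ℕ, ∑ j ∈ Finset.range n, f j =
        f i + (f (i + 1) + ∑ j ∈ ((Finset.range n).erase i).erase (i + 1), f j) := by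
      intro f
      rw [Finset.add_sum_erase _ _ (by simp; omega), Finset.add_sum_erase _ _ (by simp; omega)]
    rw [hs e, hs d]
    have : ∑ j ∈ ((Finset.range n).erase i).erase (i + 1), e j =
        ∑ j ∈ ((Finset.range n).erase i).erase (i + 1), d j := by
      refine Finset.sum_congr rfl fun j hj => ?_
      simp only [Finset.mem_erase] at hj
      exact r4 j hj.2.1 hj.1
    rw [this]; omega

lemma staircase_mem (n : ℕ) : staircase n ∈ restrictSupport ℤ (stairSet n 0) := by
  have e : staircase n = monomial (∑ i ∈ Finset.range n, Finsupp.single i (n - 1 - i)) 1 := by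
    rw [staircase, monomial_sum_one]
    simp only [X_pow_eq_monomial]
  have hv : ∀ k, (∑ i ∈ Finset.range n, Finsupp.single i (n - 1 - i)) k = n - 1 - k := by
    intro k
    rw [Finsupp.finsetSum_apply]
    simp only [Finsupp.single_apply]
    rw [Finset.sum_ite_eq']
    simp only [Finset.mem_range]
    split_ifs <;> omega
  rw [e, monomial_mem_restrictSupport]
  left
  refine ⟨fun i => (hv i).le, ?_⟩
  simp only [hv, add_zero]

lemma ddW_stair_mem (n : ℕ) (a : List ℕ) :
    ddW a (staircase n) ∈ restrictSupport ℤ (stairSet n a.length) := by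
  induction a with
  | nil => exact staircase_mem n
  | cons i a ih =>
    exact restrictSupport_mono ℤ (expImg_stairSet i n a.length) (divDiff_supp i _ _ ih)

lemma ddL_stair_zero (n k i : ℕ) (hi : n ≤ i + 1) (f : PolyRing)
    (hf : f ∈ restrictSupport ℤ (stairSet n k)) : ddL i f = 0 := by
  have h : ddL i f ∈ restrictSupport ℤ (expImg i (stairSet n k)) := divDiff_supp i _ _ hf
  have he : expImg i (stairSet n k) = ∅ := by
    ext e
    simp only [Set.mem_empty_iff_false, iff_false]
    rintro ⟨d, ⟨h1, h2⟩, r1, r2, r3, r4⟩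
    have := h1 i
    have := h1 (i + 1)
    omega
  rw [he, mem_restrictSupport_iff] at h
  simpa using h

lemma ddW_stair_zero (n : ℕ) (a : List ℕ) (h : ∃ i ∈ a, n ≤ i + 1) : ddW a (staircase n) = 0 := by
  induction a with
  | nil => simp at h
  | cons i a ih =>
    rw [ddW_cons, LinearMap.comp_apply]
    by_cases hi : n ≤ i + 1
    · exact ddL_stair_zero n a.length i hi _ (ddW_stair_mem n a)
    · rw [ih, map_zero]
      obtain ⟨j, hj, hj'⟩ := h
      rcases List.mem_cons.1 hj with h | h
      · omega
      · exact ⟨j, h, hj'⟩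

lemma topLen (n : ℕ) : len (wZero n) = ∑ i ∈ Finset.range n, (n - 1 - i) := by
  have h1 := ddW_stair_mem n (topWord n)
  rw [ddW_topWord, mem_restrictSupport_iff] at h1
  have h2 := h1 (show (0 : ℕ →₀ ℕ) ∈ ((1 : PolyRing).support : Set _) by simp)
  have h3 := h2.2
  have h4 := red_topWord n
  unfold red at h4
  rw [h4, wprod_topWord] at h3
  simpa using h3

lemma wprod_supp (n : ℕ) (a : List ℕ) (h : ∀ i ∈ a, i + 1 < n) : ∀ k, wprod a k ≠ k → k < n := by
  induction a with
  | nil => intro k hk; simp [wprod_nil] at hk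
  | cons i a ih =>
    intro k hk
    by_contra hc
    apply hk
    have hi := h i List.mem_cons_self
    have : wprod a k = k := by
      by_contra hh
      exact hc (ih (fun j hj => h j (List.mem_cons_of_mem _ hj)) k hh)
    rw [wprod_cons, Equiv.Perm.mul_apply, this, sT_e _ _ (by omega) (by omega)]

/-- The basic evaluation. -/
lemma stair_eval (n : ℕ) (a : List ℕ) :
    constantCoeff (ddW a (staircase n)) =
      if a.length = len (wZero n) ∧ wprod a = wZero n then 1 else 0 := by
  split_ifs with h
  · rw [ddW_wZero n a (by unfold red; rw [h.1, h.2]) h.2]; simp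
  · by_cases hl : a.length = len (wZero n)
    · by_cases ra : red a
      · by_cases hr : ∀ i ∈ a, i + 1 < n
        · exfalso
          apply h
          refine ⟨hl, eq_of_invS_eq _ _ ?_⟩
          rw [invS_wZero]
          apply Set.eq_of_subset_of_ncard_le (invS_sub _ n (wprod_supp n a hr)) _ (fin_tri n)
          rw [← invS_wZero, ← len_eq, ← len_eq, ← hl, ra]
        · push Not at hr
          rw [ddW_stair_zero n a hr]; simp
      · rw [ddW_nonred a ra]; simp
    · have := ddW_stair_mem n a
      rw [mem_restrictSupport_iff] at this
      by_contra hc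
      have h0 : (0 : ℕ →₀ ℕ) ∈ ((ddW a (staircase n)).support : Set _) := by
        rw [Finset.mem_coe, mem_support_iff]; exact hc
      have h1 := (this h0).2
      rw [← topLen] at h1
      simp at h1
      exact hl h1

/-! ### Finiteness and separation by the functionals -/

/-- exponents of total degree less than `k` -/
def degSet (k : ℕ) : Set (ℕ →₀ ℕ) := {e | e.degree < k}

lemma expRel_degree (i : ℕ) (d e : ℕ →₀ ℕ) (h : expRel i d e) : e.degree + 1 = d.degree := by
  obtain ⟨r1, r2, r3, r4⟩ := h
  have key : e + Finsupp.single i (d i) + Finsupp.single (i + 1) (d (i + 1)) =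
      d + Finsupp.single i (e i) + Finsupp.single (i + 1) (e (i + 1)) := by
    ext k
    by_cases a : k = i
    · subst a; simp; omega
    · by_cases b : k = i + 1
      · subst b; simp; omega
      · simp [r4 k a b, Ne.symm a, Ne.symm b]
  have := congrArg Finsupp.degree key
  simp only [map_add, Finsupp.degree_single] at this
  omega

lemma ddL_degSet (i k : ℕ) (f : PolyRing) (hf : f ∈ restrictSupport ℤ (degSet (k + 1))) :
    ddL i f ∈ restrictSupport ℤ (degSet k) := by
  refine restrictSupport_mono ℤ ?_ (divDiff_supp i f _ hf)
  rintro e ⟨d, hd, h⟩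
  have := expRel_degree i d e h
  have hd' : d.degree < k + 1 := hd
  change e.degree < k
  omega

lemma exists_degSet (f : PolyRing) : ∃ k, f ∈ restrictSupport ℤ (degSet k) := by
  refine ⟨f.support.sup Finsupp.degree + 1, ?_⟩
  rw [mem_restrictSupport_iff]
  intro e he
  exact Nat.lt_succ_of_le (Finset.le_sup (f := Finsupp.degree) he)

lemma degSet_zero (f : PolyRing) (hf : f ∈ restrictSupport ℤ (degSet 0)) : f = 0 := by
  have : degSet 0 = ∅ := by ext; simp [degSet]
  rw [this, mem_restrictSupport_iff] at hf
  simpa using hf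

lemma ddL_finite (f : PolyRing) : {i | ddL i f ≠ 0}.Finite := by
  have : {i | ddL i f ≠ 0} ⊆ ⋃ d ∈ f.support,
      ((d.support : Set ℕ) ∪ (fun i => i + 1) ⁻¹' (d.support : Set ℕ)) := by
    intro i hi
    have h : ddL i f ∈ restrictSupport ℤ (expImg i (f.support : Set _)) :=
      divDiff_supp i f _ (by rw [mem_restrictSupport_iff])
    rw [mem_restrictSupport_iff] at h
    obtain ⟨e, he⟩ := support_nonempty.2 hi
    obtain ⟨d, hd, r1, r2, r3, r4⟩ := h he
    simp only [Set.mem_iUnion]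
    refine ⟨d, hd, ?_⟩
    simp only [Set.mem_union, Set.mem_preimage, Finset.mem_coe, Finsupp.mem_support_iff]
    omega
  refine Set.Finite.subset ?_ this
  refine Set.Finite.biUnion f.support.finite_toSet fun d _ => ?_
  refine d.support.finite_toSet.union (d.support.finite_toSet.preimage ?_)
  intro a _ b _ h
  simpa using h

lemma words_finite (k : ℕ) : ∀ f : PolyRing, f ∈ restrictSupport ℤ (degSet k) →
    {a : List ℕ | ddW a f ≠ 0}.Finite := by
  induction k with
  | zero =>
    intro f hf
    rw [degSet_zero f hf]
    simp
  | succ k ih =>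
    intro f hf
    have : {a : List ℕ | ddW a f ≠ 0} ⊆ {[]} ∪ ⋃ i ∈ {i | ddL i f ≠ 0},
        (fun a : List ℕ => a ++ [i]) '' {a | ddW a (ddL i f) ≠ 0} := by
      intro a ha
      rcases List.eq_nil_or_concat' a with rfl | ⟨b, i, rfl⟩
      · left; rfl
      · right
        have ha' : ddW b (ddL i f) ≠ 0 := by
          intro h
          apply ha
          rw [ddW_append, LinearMap.comp_apply]
          exact h
        simp only [Set.mem_iUnion]
        refine ⟨i, ?_, b, ha', rfl⟩
        intro h
        rw [h, map_zero] at ha'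
        exact ha' rfl
    refine Set.Finite.subset ?_ this
    refine (Set.finite_singleton _).union ?_
    refine Set.Finite.biUnion (ddL_finite f) fun i _ => ?_
    exact (ih _ (ddL_degSet i k f hf)).image _

lemma eq_zero_of_sym (g : PolyRing) (h : ∀ i, rename (sT i) g = g) (h0 : constantCoeff g = 0) :
    g = 0 := by
  by_cases hv : g.vars.Nonempty
  · exfalso
    set m := g.vars.max' hv
    have hm : m ∈ (rename (sT m) g).vars := by rw [h m]; exact Finset.max'_mem _ _
    obtain ⟨j, hj, hjm⟩ := mem_vars_rename _ _ hm
    have : j ≤ m := Finset.le_max' _ _ hj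
    rw [sT_apply] at hjm
    split_ifs at hjm <;> omega
  · rw [Finset.not_nonempty_iff_eq_empty] at hv
    rw [vars_eq_empty_iff_eq_C] at hv
    have hv' : g = C (constantCoeff g) := hv
    rw [hv', h0, map_zero]

lemma eq_zero_of_func (k : ℕ) : ∀ g : PolyRing, g ∈ restrictSupport ℤ (degSet k) →
    (∀ a, constantCoeff (ddW a g) = 0) → g = 0 := by
  induction k with
  | zero => intro g hg _; exact degSet_zero g hg
  | succ k ih =>
    intro g hg h
    refine eq_zero_of_sym g (fun i => ?_) (h [])
    rw [← ddL_eq_zero_iff]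
    refine ih _ (ddL_degSet i k g hg) fun a => ?_
    have := h (a ++ [i])
    rw [ddW_append, LinearMap.comp_apply] at this
    exact this

/-! ### Schubert polynomials -/

lemma exists_bound (w : Equiv.Perm ℕ) (hw : {i : ℕ | w i ≠ i}.Finite) :
    ∃ n : ℕ, ∀ i, w i ≠ i → i < n := by
  obtain ⟨n, hn⟩ := hw.bddAbove
  exact ⟨n + 1, fun i hi => Nat.lt_succ_of_le (hn hi)⟩

lemma fin_of_bound (w : Equiv.Perm ℕ) (n : ℕ) (hw : ∀ i, w i ≠ i → i < n) : (invS w).Finite :=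
  (fin_tri n).subset (invS_sub w n hw)

lemma schubert_repr (w : Equiv.Perm ℕ) (hw : {i : ℕ | w i ≠ i}.Finite) :
    ∃ n b, (∀ i, w i ≠ i → i < n) ∧ wprod b = w⁻¹ * wZero n ∧ b.length = len (w⁻¹ * wZero n) ∧
      schubert w = ddW b (staircase n) := by
  have h := exists_bound w hw
  have h2 : ∃ a : List ℕ, IsReducedWord (w⁻¹ * wZero h.choose) a :=
    exists_word _ (fin_of_bound _ h.choose (supp_mul_wZero w _ h.choose_spec))
  refine ⟨h.choose, h2.choose, h.choose_spec, h2.choose_spec.1, h2.choose_spec.2, ?_⟩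
  rw [schubert, dif_pos h, schubertIn, dif_pos h2, ddW_apply]

lemma schubert_eval (w : Equiv.Perm ℕ) (hw : {i : ℕ | w i ≠ i}.Finite) (a : List ℕ) (ha : red a) :
    constantCoeff (ddW a (schubert w)) = if wprod a = w then 1 else 0 := by
  obtain ⟨n, b, hn, hb, hbl, e⟩ := schubert_repr w hw
  rw [e, ← LinearMap.comp_apply, ← ddW_append, stair_eval, wprod_append, hb]
  have hl := len_compl w n hn
  by_cases h : wprod a = w
  · rw [if_pos h, if_pos]
    refine ⟨?_, by rw [h]; group⟩
    rw [List.length_append, hbl, ha, h, hl]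
  · rw [if_neg h, if_neg]
    rintro ⟨_, h2⟩
    apply h
    rw [← mul_assoc] at h2
    exact mul_inv_eq_one.1 (mul_eq_right.1 h2)

lemma wprod_fin (a : List ℕ) : {i : ℕ | wprod a i ≠ i}.Finite := by
  obtain ⟨n, hn⟩ : ∃ n, ∀ i ∈ a, i + 1 < n := by
    obtain ⟨m, hm⟩ := a.toFinset.finite_toSet.bddAbove
    refine ⟨m + 2, fun i hi => ?_⟩
    have : i ≤ m := hm (by simpa using hi)
    omega
  exact (Set.finite_lt_nat n).subset (fun i hi => wprod_supp n a hn i hi)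

/-- The functional attached to a word. -/
noncomputable def wordFun (a : List ℕ) : PolyRing →ₗ[ℤ] ℤ :=
  (constantCoeff : PolyRing →+* ℤ).toAddMonoidHom.toIntLinearMap.comp (ddW a)

lemma wordFun_apply (a : List ℕ) (f : PolyRing) : wordFun a f = constantCoeff (ddW a f) := rfl

/-- The Schubert polynomials `{𝔖_w : w ∈ S_∞}` form a ℤ-basis of the polynomial
ring ℤ[x₁,x₂,…]: they are ℤ-linearly independent, and every polynomial is a ℤ-linear
combination of finitely many of them (the span is everything). -/
theorem schubert_basis :
    LinearIndependent ℤ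
      (fun w : {w : Equiv.Perm ℕ // {i : ℕ | w i ≠ i}.Finite} => schubert w.1) ∧
    Submodule.span ℤ
      (Set.range fun w : {w : Equiv.Perm ℕ // {i : ℕ | w i ≠ i}.Finite} => schubert w.1) = ⊤ := by
  have hex : ∀ w : {w : Equiv.Perm ℕ // {i : ℕ | w i ≠ i}.Finite},
      ∃ a, wprod a = w.1 ∧ a.length = len w.1 := fun w => by
    obtain ⟨n, hn⟩ := exists_bound w.1 w.2
    exact exists_word w.1 (fin_of_bound _ n hn)
  choose A hA hAl using hex
  have hAr : ∀ w, red (A w) := fun w => by unfold red; rw [hA, hAl]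
  have hAe : ∀ v w, wordFun (A v) (schubert w.1) = if v = w then 1 else 0 := by
    intro v w
    rw [wordFun_apply, schubert_eval w.1 w.2 _ (hAr v), hA]
    simp only [Subtype.ext_iff]
  constructor
  · refine LinearIndependent.of_pairwise_dual_eq_zero_one _ (fun v => wordFun (A v)) ?_ ?_
    · intro v w hvw
      rw [hAe, if_neg]
      first | exact hvw | exact hvw.symm
    · intro v
      rw [hAe, if_pos rfl]
  · rw [eq_top_iff]
    intro f _
    obtain ⟨k, hk⟩ := exists_degSet f
    have hfin := words_finite k f hk
    set F : Finset {w : Equiv.Perm ℕ // {i : ℕ | w i ≠ i}.Finite} :=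
      hfin.toFinset.image (fun a => ⟨wprod a, wprod_fin a⟩) with hF
    have hz : f - ∑ v ∈ F, wordFun (A v) f • schubert v.1 = 0 := by
      obtain ⟨m, hm⟩ := exists_degSet (f - ∑ v ∈ F, wordFun (A v) f • schubert v.1)
      refine eq_zero_of_func m _ hm fun a => ?_
      by_cases ra : red a
      · rw [← wordFun_apply, map_sub, map_sum]
        set u : {w : Equiv.Perm ℕ // {i : ℕ | w i ≠ i}.Finite} := ⟨wprod a, wprod_fin a⟩ with hu
        have hau : wordFun a = wordFun (A u) := by
          unfold wordFun
          rw [matsumoto a (A u) ra (hAr u) (by rw [hA])]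
        have e : ∀ v, wordFun a (wordFun (A v) f • schubert v.1) =
            if u = v then wordFun (A v) f else 0 := by
          intro v
          rw [map_smul, hau, hAe]
          simp
        simp only [e]
        rw [Finset.sum_ite_eq]
        split_ifs with h
        · rw [hau, sub_self]
        · rw [sub_zero]
          by_contra hc
          apply h
          rw [hF, Finset.mem_image]
          refine ⟨a, ?_, rfl⟩
          rw [Set.Finite.mem_toFinset]
          intro h0
          apply hc
          rw [wordFun_apply, h0, map_zero]
      · rw [ddW_nonred a ra]; simp
    rw [sub_eq_zero.1 hz]
    exact Submodule.sum_mem _ fun v _ => Submodule.smul_mem _ _ (Submodule.subset_span ⟨v, rfl⟩)
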